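/- For N = {1,2,3,4} and A = {a,b,c,d}, there is no SDS on the full domain of weak preferences that is anonymous, neutral, sd-efficient, sd-strategyproof, and extends random dictatorship. -/

import Mathlib

open Finset
open scoped Classical

section Framework

variable {A : Type*} [Fintype A] {n : ℕ}

/-- `p` is a lottery (probability distribution) on the set of alternatives `A`. -/
def IsLottery (p : A → ℝ) : Prop := (∀ x, 0 ≤ p x) ∧ ∑ x, p x = 1

/-- `r` is a weak preference relation: complete (total) and transitive. -/
def IsPref (r : A → A → Prop) : Prop := Total r ∧ Transitive r

/-- A preference profile assigns a weak preference relation to each of the `n` agents. -/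
def IsProfile (R : Fin n → A → A → Prop) : Prop := ∀ i, IsPref (R i)

/-- The probability that `p` assigns to alternatives weakly preferred (by `r`) to `x`. -/
noncomputable def upperProb (r : A → A → Prop) (p : A → ℝ) (x : A) : ℝ :=
  ∑ y ∈ univ.filter (fun y => r y x), p y

/-- Stochastic dominance: `p ≽^sd q` w.r.t. the preference relation `r`. -/
def SDge (r : A → A → Prop) (p q : A → ℝ) : Prop :=
  ∀ x, upperProb r q x ≤ upperProb r p x

/-- Strict stochastic dominance: `p ≻^sd q` w.r.t. the preference relation `r`. -/
def SDgt (r : A → A → Prop) (p q : A → ℝ) : Prop :=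
  SDge r p q ∧ ¬ SDge r q p

/-- A social decision scheme maps every preference profile to a lottery. -/
def IsSDS (f : (Fin n → A → A → Prop) → (A → ℝ)) : Prop :=
  ∀ R : Fin n → A → A → Prop, IsProfile R → IsLottery (f R)

/-- Anonymity: invariance under permutations of the agents. -/
def Anonymous (f : (Fin n → A → A → Prop) → (A → ℝ)) : Prop :=
  ∀ R : Fin n → A → A → Prop, IsProfile R → ∀ π : Equiv.Perm (Fin n),
    f (fun i => R (π i)) = f R

/-- Neutrality: `f(R^σ)(σ x) = f(R)(x)`, where `R^σ` relabels alternatives by `σ`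
(i.e. `σ x ≽^σ_i σ y ↔ x ≽_i y`). -/
def Neutral (f : (Fin n → A → A → Prop) → (A → ℝ)) : Prop :=
  ∀ R : Fin n → A → A → Prop, IsProfile R → ∀ σ : Equiv.Perm A, ∀ x : A,
    f (fun i u v => R i (σ.symm u) (σ.symm v)) (σ x) = f R x

/-- The lottery `p` is sd-efficient for the profile `R`: no lottery `q` is weakly
sd-preferred to `p` by all agents and strictly sd-preferred by some agent. -/
def SDEfficientLottery (R : Fin n → A → A → Prop) (p : A → ℝ) : Prop :=
  ¬ ∃ q : A → ℝ, IsLottery q ∧ (∀ i, SDge (R i) q p) ∧ (∃ i, SDgt (R i) q p)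

/-- sd-efficiency of a social decision scheme. -/
def SDEfficient (f : (Fin n → A → A → Prop) → (A → ℝ)) : Prop :=
  ∀ R : Fin n → A → A → Prop, IsProfile R → SDEfficientLottery R (f R)

/-- sd-strategyproofness: no agent can misreport and obtain a strictly
sd-preferred lottery. -/
def SDStrategyproof (f : (Fin n → A → A → Prop) → (A → ℝ)) : Prop :=
  ∀ R R' : Fin n → A → A → Prop, IsProfile R → IsProfile R' → ∀ i : Fin n,
    (∀ j, j ≠ i → R j = R' j) → ¬ SDgt (R i) (f R') (f R)

/-- `x` is the unique most-preferred alternative of the relation `r`. -/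
def UniqueTop (r : A → A → Prop) (x : A) : Prop :=
  ∀ y, y ≠ x → r x y ∧ ¬ r y x

/-- `f` extends random dictatorship: whenever every agent has a unique top choice,
each alternative gets probability (number of agents having it as top)/n. -/
def ExtendsRD (f : (Fin n → A → A → Prop) → (A → ℝ)) : Prop :=
  ∀ R : Fin n → A → A → Prop, IsProfile R →
    ∀ t : Fin n → A, (∀ i, UniqueTop (R i) (t i)) →
      ∀ x : A, f R x = ((univ.filter (fun i => t i = x)).card : ℝ) / (n : ℝ)

/-- `x` is Pareto-dominated in the profile `R`. -/
def Pareto_Dominated (R : Fin n → A → A → Prop) (x : A) : Prop :=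
  ∃ y : A, (∀ i, R i y x) ∧ ∃ i, R i y x ∧ ¬ R i x y

end Framework

/-- The weak preference relation in which alternatives of lower rank are better. -/
def rankPref {A : Type*} (ρ : A → ℕ) (x y : A) : Prop := ρ x ≤ ρ y

theorem isPref_rankPref {A : Type*} (ρ : A → ℕ) : IsPref (rankPref ρ) :=
  ⟨fun x y => le_total (ρ x) (ρ y), fun _ _ _ => le_trans⟩

/-- The profile in which agent `i` has the preferences induced by the rank function `ρ i`. -/
def rankProfile {A : Type*} {n : ℕ} (ρ : Fin n → A → ℕ) (i : Fin n) : A → A → Prop :=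
  rankPref (ρ i)

theorem isProfile_rankProfile {A : Type*} {n : ℕ} (ρ : Fin n → A → ℕ) :
    IsProfile (rankProfile ρ) :=
  fun i => isPref_rankPref (ρ i)

theorem upperProb_rankProfile {n : ℕ} (ρ : Fin n → Fin 4 → ℕ) (i : Fin n) (p : Fin 4 → ℝ)
    (x : Fin 4) :
    upperProb (rankProfile ρ i) p x =
      (if ρ i 0 ≤ ρ i x then p 0 else 0) + (if ρ i 1 ≤ ρ i x then p 1 else 0) +
        (if ρ i 2 ≤ ρ i x then p 2 else 0) + (if ρ i 3 ≤ ρ i x then p 3 else 0) := by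
  unfold upperProb
  rw [Finset.sum_filter, Fin.sum_univ_four]
  refine congrArg₂ (· + ·) (congrArg₂ (· + ·) (congrArg₂ (· + ·) ?_ ?_) ?_) ?_ <;>
    exact if_congr Iff.rfl rfl rfl

theorem IsLottery.nonneg_and_sum_four {p : Fin 4 → ℝ} (hp : IsLottery p) :
    0 ≤ p 0 ∧ 0 ≤ p 1 ∧ 0 ≤ p 2 ∧ 0 ≤ p 3 ∧ p 0 + p 1 + p 2 + p 3 = 1 :=
  ⟨hp.1 0, hp.1 1, hp.1 2, hp.1 3, by rw [← Fin.sum_univ_four]; exact hp.2⟩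

/-- Under anonymity and neutrality, alternatives exchanged by a symmetry of the profile get the
same probability. -/
theorem apply_eq_of_symmetry {A : Type*} [Fintype A] {n : ℕ}
    {f : (Fin n → A → A → Prop) → (A → ℝ)} (hanon : Anonymous f) (hneut : Neutral f)
    (ρ : Fin n → A → ℕ) (π : Equiv.Perm (Fin n)) (σ : Equiv.Perm A)
    (h : ∀ i x, ρ i (σ.symm x) = ρ (π i) x) (x : A) :
    f (rankProfile ρ) (σ x) = f (rankProfile ρ) x := by
  have hσ := hneut (rankProfile ρ) (isProfile_rankProfile ρ) σ x
  have hπ := hanon (rankProfile ρ) (isProfile_rankProfile ρ) π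
  have heq : (fun i u v => rankProfile ρ i (σ.symm u) (σ.symm v)) =
      fun i => rankProfile ρ (π i) := by
    funext i u v
    simp only [rankProfile, rankPref, h]
  rwa [heq, hπ] at hσ

/-- An agent whose only strict preference is for `c` over everything else receives `c` for sure
if some misreport leads to the lottery that selects `c` for sure. -/
theorem apply_two_eq_one_of_misreport {f : (Fin 4 → Fin 4 → Fin 4 → Prop) → (Fin 4 → ℝ)}
    (hsds : IsSDS f) (hsp : SDStrategyproof f) (ρ ρ' : Fin 4 → Fin 4 → ℕ) (i : Fin 4)
    (hi : ρ i = ![1, 1, 0, 1]) (hne : ∀ j, j ≠ i → ρ j = ρ' j)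
    (h : f (rankProfile ρ') 2 = 1) : f (rankProfile ρ) 2 = 1 := by
  by_contra hlt
  obtain ⟨p0, p1, p2, p3, ps⟩ := (hsds _ (isProfile_rankProfile ρ)).nonneg_and_sum_four
  obtain ⟨q0, q1, q2, q3, qs⟩ := (hsds _ (isProfile_rankProfile ρ')).nonneg_and_sum_four
  have hpq := hsp (rankProfile ρ) (rankProfile ρ') (isProfile_rankProfile ρ)
    (isProfile_rankProfile ρ') i (fun j hj => by simp only [rankProfile, hne j hj])
  generalize f (rankProfile ρ) = p at *
  generalize f (rankProfile ρ') = q at *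
  have hlt' : p 2 < 1 := lt_of_le_of_ne (by linarith) hlt
  refine hpq ⟨fun x => ?_, fun hx => ?_⟩
  · fin_cases x <;> simp [upperProb_rankProfile, hi] <;> linarith
  · have := hx 2
    simp [upperProb_rankProfile, hi] at this
    linarith

/-- At the profile `{ab}{cd}`, `{ac}bd`, `{bd}ca`, `{cd}{ab}`, the lottery is supported on
`{b, c}`. -/
theorem apply_eq_zero_of_reversal_symmetric_profile
    {f : (Fin 4 → Fin 4 → Fin 4 → Prop) → (Fin 4 → ℝ)}
    (hsds : IsSDS f) (hanon : Anonymous f) (hneut : Neutral f) (heff : SDEfficient f) :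
    f (rankProfile ![![0, 0, 1, 1], ![0, 1, 0, 2], ![2, 0, 1, 0], ![1, 1, 0, 0]]) 0 = 0 ∧
    f (rankProfile ![![0, 0, 1, 1], ![0, 1, 0, 2], ![2, 0, 1, 0], ![1, 1, 0, 0]]) 3 = 0 := by
  set ρ : Fin 4 → Fin 4 → ℕ :=
    ![![0, 0, 1, 1], ![0, 1, 0, 2], ![2, 0, 1, 0], ![1, 1, 0, 0]] with hρ
  have hsymm := apply_eq_of_symmetry hanon hneut ρ Fin.revPerm Fin.revPerm (by decide)
  have h03 : f (rankProfile ρ) 3 = f (rankProfile ρ) 0 := hsymm 0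
  obtain ⟨p0, p1, p2, p3, ps⟩ := (hsds _ (isProfile_rankProfile ρ)).nonneg_and_sum_four
  suffices h0 : f (rankProfile ρ) 0 = 0 from ⟨h0, h03.trans h0⟩
  have hp := heff _ (isProfile_rankProfile ρ)
  clear hsymm
  generalize f (rankProfile ρ) = p at *
  by_contra hne
  have hpos : 0 < p 0 := lt_of_le_of_ne p0 (Ne.symm hne)
  have hge : ∀ i, SDge (rankProfile ρ i)
      ![0, p 1 + p 0, p 2 + p 0, 0] p := by
    intro i x
    fin_cases i <;> fin_cases x <;> simp [upperProb_rankProfile, hρ] <;> linarith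
  refine hp ⟨_, ⟨?_, ?_⟩, hge, 1, hge 1, ?_⟩
  · intro x
    fin_cases x <;> simp <;> linarith
  · simp [Fin.sum_univ_four]
    linarith
  · intro hle
    have := hle 1
    simp [upperProb_rankProfile, hρ] at this
    linarith

/-- At the profile `{ab}{cd}`, `{ac}bd`, `{bc}ad`, `{cd}{ab}`, alternative `c` is chosen for
sure. -/
theorem apply_two_eq_one_of_symmetric_profile
    {f : (Fin 4 → Fin 4 → Fin 4 → Prop) → (Fin 4 → ℝ)}
    (hsds : IsSDS f) (hanon : Anonymous f) (hneut : Neutral f) (heff : SDEfficient f)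
    (hsp : SDStrategyproof f) :
    f (rankProfile ![![0, 0, 1, 1], ![0, 1, 0, 2], ![1, 0, 0, 2], ![1, 1, 0, 0]]) 2 = 1 := by
  obtain ⟨q0, q3⟩ := apply_eq_zero_of_reversal_symmetric_profile hsds hanon hneut heff
  set ρ' : Fin 4 → Fin 4 → ℕ :=
    ![![0, 0, 1, 1], ![0, 1, 0, 2], ![2, 0, 1, 0], ![1, 1, 0, 0]]
  set ρ : Fin 4 → Fin 4 → ℕ :=
    ![![0, 0, 1, 1], ![0, 1, 0, 2], ![1, 0, 0, 2], ![1, 1, 0, 0]] with hρ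
  have h10 : f (rankProfile ρ) 1 = f (rankProfile ρ) 0 :=
    apply_eq_of_symmetry hanon hneut ρ (Equiv.swap 1 2) (Equiv.swap 0 1) (by decide) 0
  obtain ⟨p0, p1, p2, p3, ps⟩ := (hsds _ (isProfile_rankProfile ρ)).nonneg_and_sum_four
  obtain ⟨-, -, -, -, qs⟩ := (hsds _ (isProfile_rankProfile ρ')).nonneg_and_sum_four
  have hp := heff _ (isProfile_rankProfile ρ)
  have hpq := hsp (rankProfile ρ) (rankProfile ρ') (isProfile_rankProfile ρ)
    (isProfile_rankProfile ρ') 2 (fun j hj => congrArg rankPref (by revert j; decide))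
  generalize f (rankProfile ρ) = p at *
  generalize f (rankProfile ρ') = q at *
  have h3 : p 3 = 0 := by
    by_contra hne
    have hpos : 0 < p 3 := lt_of_le_of_ne p3 (Ne.symm hne)
    have hge : ∀ i, SDge (rankProfile ρ i)
        ![p 0, p 1, p 2 + p 3, 0] p := by
      intro i x
      fin_cases i <;> fin_cases x <;> simp [upperProb_rankProfile, hρ] <;> linarith
    refine hp ⟨_, ⟨?_, ?_⟩, hge, 1, hge 1, ?_⟩
    · intro x
      fin_cases x <;> simp <;> linarith
    · simp [Fin.sum_univ_four]
      linarith
    · intro hle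
      have := hle 0
      simp [upperProb_rankProfile, hρ] at this
      linarith
  by_contra hlt
  have h0 : 0 < p 0 := lt_of_le_of_ne p0 fun h => hlt (by linarith)
  refine hpq ⟨fun x => ?_, fun hx => ?_⟩
  · fin_cases x <;> simp [upperProb_rankProfile, hρ] <;> linarith
  · have := hx 1
    simp [upperProb_rankProfile, hρ] at this
    linarith

/-- For `N = {1,2,3,4}` and `A = {a,b,c,d}` (encoded as `Fin 4`), there is no SDS
on the full domain of weak preferences that is anonymous, neutral, sd-efficient,
sd-strategyproof, and extends random dictatorship. -/
theorem no_good_rd_extension_four :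
    ¬ ∃ f : (Fin 4 → Fin 4 → Fin 4 → Prop) → (Fin 4 → ℝ),
        IsSDS f ∧ Anonymous f ∧ Neutral f ∧ SDEfficient f ∧ SDStrategyproof f ∧
          ExtendsRD f := by
  rintro ⟨f, hsds, hanon, hneut, heff, hsp, hrd⟩
  have h₀ := apply_two_eq_one_of_symmetric_profile hsds hanon hneut heff hsp
  have h₁ := apply_two_eq_one_of_misreport hsds hsp
    ![![0, 0, 1, 1], ![0, 1, 0, 2], ![1, 0, 0, 2], ![1, 1, 0, 1]] _ 3 rfl (by decide) h₀
  have h₂ := apply_two_eq_one_of_misreport hsds hsp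
    ![![0, 0, 1, 1], ![0, 1, 0, 2], ![1, 1, 0, 1], ![1, 1, 0, 1]] _ 2 rfl (by decide) h₁
  have h₃ := apply_two_eq_one_of_misreport hsds hsp
    ![![0, 0, 1, 1], ![1, 1, 0, 1], ![1, 1, 0, 1], ![1, 1, 0, 1]] _ 1 rfl (by decide) h₂
  clear h₀ h₁ h₂
  set ρ : Fin 4 → Fin 4 → ℕ :=
    ![![0, 0, 1, 1], ![1, 1, 0, 1], ![1, 1, 0, 1], ![1, 1, 0, 1]] with hρ
  set ρ' : Fin 4 → Fin 4 → ℕ :=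
    ![![0, 1, 1, 1], ![1, 1, 0, 1], ![1, 1, 0, 1], ![1, 1, 0, 1]]
  obtain ⟨p0, p1, p2, p3, ps⟩ := (hsds _ (isProfile_rankProfile ρ)).nonneg_and_sum_four
  obtain ⟨q0, q1, q2, q3, qs⟩ := (hsds _ (isProfile_rankProfile ρ')).nonneg_and_sum_four
  have htop : ∀ i, UniqueTop (rankProfile ρ' i) ((![0, 2, 2, 2] : Fin 4 → Fin 4) i) := by
    unfold UniqueTop rankProfile rankPref
    decide
  have hq : 0 < f (rankProfile ρ') 0 := by
    rw [hrd _ (isProfile_rankProfile ρ') _ htop 0]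
    exact div_pos (Nat.cast_pos.2 (Finset.card_pos.2 ⟨0, by simp⟩)) (by norm_num)
  have hpq := hsp (rankProfile ρ) (rankProfile ρ') (isProfile_rankProfile ρ)
    (isProfile_rankProfile ρ') 0 (fun j hj => congrArg rankPref (by revert j; decide))
  generalize f (rankProfile ρ) = p at *
  generalize f (rankProfile ρ') = q at *
  refine hpq ⟨fun x => ?_, fun hx => ?_⟩
  · fin_cases x <;> simp [upperProb_rankProfile, hρ] <;> linarith
  · have := hx 0
    simp [upperProb_rankProfile, hρ] at this
    linarith
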